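/- arXiv:1905.02806 — 3 statements merged into one kernel-verified Lean document; each statement's English description precedes it below -/
import Mathlib

section
/- Let K be a field of characteristic zero, V a K-vector space of dimension 2n with n ≥ 3, and ω an element of the second exterior power Λ²(V) whose n-th exterior power ω^{∧n} is nonzero in Λ^{2n}(V) (equivalently, ω is nondegenerate). Then the linear map Λ²(V) → Λ⁴(V) given by α ↦ ω ∧ α is injective. -/
namespace ExteriorAlgebra

open CliffordAlgebra (contractLeft contractLeft_ι_mul contractLeft_ι contractLeft_algebraMap
  contractLeft_comm)

section CommRing

variable {R M : Type*} [CommRing R] [AddCommGroup M] [Module R M]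

@[elab_as_elim]
theorem induction_exteriorPower_two {p : ∀ ω : ExteriorAlgebra R M, ω ∈ ⋀[R]^2 M → Prop}
    (hι : ∀ x y h, p (ι R x * ι R y) h)
    (hadd : ∀ a ha b hb, p a ha → p b hb → p (a + b) (add_mem ha hb))
    {ω : ExteriorAlgebra R M} (hω : ω ∈ ⋀[R]^2 M) : p ω hω := by
  have hω' := hω
  rw [exteriorPower, pow_two] at hω'
  suffices ∃ h, p ω h from this.2
  refine Submodule.mul_induction_on hω' ?_ fun a b ⟨ha, ha'⟩ ⟨hb, hb'⟩ =>
    ⟨add_mem ha hb, hadd a ha b hb ha' hb'⟩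
  rintro _ ⟨x, rfl⟩ _ ⟨y, rfl⟩
  have h : ι R x * ι R y ∈ ⋀[R]^2 M := by
    rw [exteriorPower, pow_two]
    exact Submodule.mul_mem_mul ⟨x, rfl⟩ ⟨y, rfl⟩
  exact ⟨h, hι x y h⟩

theorem contractLeft_ι_mul_ι (d : Module.Dual R M) (x y : M) :
    contractLeft d (ι R x * ι R y) = ι R (d x • y - d y • x) := by
  rw [contractLeft_ι_mul, contractLeft_ι, map_sub, map_smul, map_smul,
    ← Algebra.commutes, ← Algebra.smul_def]

/-- Contraction by a linear form is a derivation on products with a bivector. -/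
theorem contractLeft_mul_of_mem_two (d : Module.Dual R M) {ω : ExteriorAlgebra R M}
    (hω : ω ∈ ⋀[R]^2 M) (a : ExteriorAlgebra R M) :
    contractLeft d (ω * a) = contractLeft d ω * a + ω * contractLeft d a := by
  induction hω using induction_exteriorPower_two with
  | hι x y _ =>
    rw [contractLeft_ι_mul_ι, mul_assoc, contractLeft_ι_mul, contractLeft_ι_mul]
    simp only [map_sub, map_smul, mul_sub, sub_mul, smul_mul_assoc, mul_smul_comm, mul_assoc]
    abel
  | hadd a _ b _ ha hb => simp only [add_mul, map_add, ha, hb]; abel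

theorem contractLeft_pow_eq_zero {d : Module.Dual R M} {ω : ExteriorAlgebra R M}
    (hω : ω ∈ ⋀[R]^2 M) (h : contractLeft d ω = 0) (n : ℕ) : contractLeft d (ω ^ n) = 0 := by
  induction n with
  | zero => simp
  | succ n ih => rw [pow_succ', contractLeft_mul_of_mem_two d hω, h, ih]; simp

/-- The linear map from the dual induced by contraction into a bivector. -/
noncomputable def contractBivector (ω : ExteriorAlgebra R M) : Module.Dual R M →ₗ[R] M :=
  ιInv ∘ₗ contractLeft.flip ω

theorem ι_contractBivector {ω : ExteriorAlgebra R M} (hω : ω ∈ ⋀[R]^2 M)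
    (d : Module.Dual R M) : ι R (contractBivector ω d) = contractLeft d ω := by
  change ι R (ιInv (contractLeft d ω)) = contractLeft d ω
  induction hω using induction_exteriorPower_two with
  | hι x y _ => rw [contractLeft_ι_mul_ι, ι_leftInverse]
  | hadd a _ b _ ha hb => simp only [map_add, ha, hb]

theorem apply_contractBivector_comm {ω : ExteriorAlgebra R M} (hω : ω ∈ ⋀[R]^2 M)
    (d e : Module.Dual R M) : e (contractBivector ω d) = -d (contractBivector ω e) := by
  apply (algebraMap_leftInverse M).injective
  rw [map_neg, ← contractLeft_ι (Q := 0), ← contractLeft_ι (Q := 0)]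
  erw [ι_contractBivector hω, ι_contractBivector hω]
  exact contractLeft_comm _ _ _

theorem sum_ι_mul_contractLeft_coord {I : Type*} [Fintype I] (b : Module.Basis I R M)
    {α : ExteriorAlgebra R M} (hα : α ∈ ⋀[R]^2 M) :
    ∑ i, ι R (b i) * contractLeft (b.coord i) α = (2 : R) • α := by
  induction hα using induction_exteriorPower_two with
  | hι x y _ =>
    have hx : ∑ i, b.coord i x • ι R (b i) = ι R x := by
      simp_rw [← map_smul, ← map_sum, Module.Basis.coord_apply, b.sum_repr]
    have hy : ∑ i, b.coord i y • ι R (b i) = ι R y := by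
      simp_rw [← map_smul, ← map_sum, Module.Basis.coord_apply, b.sum_repr]
    simp_rw [contractLeft_ι_mul_ι, map_sub, map_smul, mul_sub, mul_smul_comm, ← smul_mul_assoc,
      Finset.sum_sub_distrib, ← Finset.sum_mul, hx, hy]
    rw [eq_neg_of_add_eq_zero_right (ι_add_mul_swap x y), sub_neg_eq_add, two_smul, add_mul]
  | hadd a _ b _ ha hb => simp only [map_add, mul_add, Finset.sum_add_distrib, ha, hb, smul_add]

theorem sum_contractLeft_coord_ι_mul {I : Type*} [Fintype I] (b : Module.Basis I R M)
    {α : ExteriorAlgebra R M} (hα : α ∈ ⋀[R]^2 M) :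
    ∑ i, contractLeft (b.coord i) (ι R (b i) * α) = ((Fintype.card I : R) - 2) • α := by
  rw [sub_smul, ← sum_ι_mul_contractLeft_coord b hα]
  simp_rw [contractLeft_ι_mul, Finset.sum_sub_distrib]
  simp [Nat.cast_smul_eq_nsmul]

end CommRing

section Field

variable {K V : Type*} [Field K] [AddCommGroup V] [Module K V] [FiniteDimensional K V]

theorem eq_zero_of_mem_of_finrank_lt {k : ℕ} (hk : Module.finrank K V < k)
    {x : ExteriorAlgebra K V} (hx : x ∈ ⋀[K]^k V) : x = 0 := by
  have h : Module.finrank K (⋀[K]^k V) = 0 := by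
    rw [exteriorPower.finrank_eq, Nat.choose_eq_zero_of_lt hk]
  have := Module.finrank_zero_iff.mp h
  exact congrArg Subtype.val (Subsingleton.elim (⟨x, hx⟩ : ⋀[K]^k V) 0)

/-- Contraction by a nonzero linear form is injective in top degree. -/
theorem eq_zero_of_contractLeft_eq_zero {d : Module.Dual K V} (hd : d ≠ 0)
    {x : ExteriorAlgebra K V} (hx : x ∈ ⋀[K]^(Module.finrank K V) V)
    (h : contractLeft d x = 0) : x = 0 := by
  obtain ⟨v, hv⟩ := DFunLike.ne_iff.mp hd
  have hvx : ι K v * x = 0 := by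
    refine eq_zero_of_mem_of_finrank_lt (Nat.lt_succ_self _) ?_
    rw [Nat.succ_eq_add_one, exteriorPower, pow_succ']
    exact Submodule.mul_mem_mul ⟨v, rfl⟩ hx
  have key := contractLeft_ι_mul (Q := (0 : QuadraticForm K V)) (d := d) v x
  erw [hvx] at key
  rw [map_zero, h, mul_zero, sub_zero] at key
  exact (smul_eq_zero.mp key.symm).resolve_left hv

theorem contractBivector_injective {n : ℕ} (hdim : Module.finrank K V = 2 * n)
    {ω : ExteriorAlgebra K V} (hω : ω ∈ ⋀[K]^2 V) (hn : ω ^ n ≠ 0) :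
    Function.Injective (contractBivector ω) := by
  rw [injective_iff_map_eq_zero]
  intro d hd
  by_contra hd0
  refine hn (eq_zero_of_contractLeft_eq_zero hd0 ?_ (contractLeft_pow_eq_zero hω ?_ n))
  · rw [hdim, exteriorPower, pow_mul]
    exact Submodule.pow_mem_pow _ hω n
  · rw [← ι_contractBivector hω, hd, map_zero]

/-- A bivector annihilated by a nondegenerate bivector `ω` is proportional to `ω`, up to the
scalar `dim V - 4`. -/
theorem exists_smul_eq_of_mul_eq_zero {ω α : ExteriorAlgebra K V} (hω : ω ∈ ⋀[K]^2 V)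
    (hα : α ∈ ⋀[K]^2 V) (hinj : Function.Injective (contractBivector ω)) (h : ω * α = 0) :
    ∃ t : K, ((Module.finrank K V : K) - 4) • α = t • ω := by
  let b := Module.finBasis K V
  let e := LinearEquiv.ofInjectiveOfFinrankEq _ hinj Subspace.dual_finrank_eq
  have he (d) : e d = contractBivector ω d := rfl
  let c := b.dualBasis.map e
  have hc (i) : c i = contractBivector ω (b.coord i) := by
    simp [c, he, Module.Basis.coe_dualBasis]
  have hb (i) : contractBivector ω (c.coord i) = -b i := by
    refine b.ext_elem fun j => ?_
    rw [← b.coord_apply, apply_contractBivector_comm hω, ← hc]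
    simp [Finsupp.single_apply, eq_comm]
  have hi (i) : contractLeft (c.coord i) (ι K (c i) * α) =
      ι K (b i) * contractLeft (b.coord i) α
        - c.coord i (contractBivector α (b.coord i)) • ω := by
    have h1 : ι K (c i) * α + ω * contractLeft (b.coord i) α = 0 := by
      rw [hc, ι_contractBivector hω, ← contractLeft_mul_of_mem_two _ hω, h, map_zero]
    rw [eq_neg_of_add_eq_zero_left h1, map_neg, contractLeft_mul_of_mem_two _ hω,
      ← ι_contractBivector hω, hb, ← ι_contractBivector hα, contractLeft_ι,
      ← Algebra.commutes, ← Algebra.smul_def]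
    simp only [map_neg, neg_mul]
    abel
  refine ⟨-∑ i, c.coord i (contractBivector α (b.coord i)), ?_⟩
  have hs := sum_contractLeft_coord_ι_mul c hα
  simp_rw [hi, Finset.sum_sub_distrib, sum_ι_mul_contractLeft_coord b hα, ← Finset.sum_smul,
    Fintype.card_fin] at hs
  rw [neg_smul, ← sub_eq_iff_eq_add'.mpr (sub_eq_iff_eq_add.mp hs)]
  module

end Field

end ExteriorAlgebra

/-- If `ω` is a 2-form on a `2n`-dimensional vector space (over a field of
characteristic zero, `n ≥ 3`) whose `n`-th exterior power is nonzero, then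
exterior multiplication by `ω` is injective from `Λ²(V)` to `Λ⁴(V)`. -/
theorem wedge_with_nondegenerate_two_form_injective
    (K : Type*) [Field K] [CharZero K]
    (V : Type*) [AddCommGroup V] [Module K V] [FiniteDimensional K V]
    (n : ℕ) (hn : 3 ≤ n) (hdim : Module.finrank K V = 2 * n)
    (ω : ExteriorAlgebra K V) (hω : ω ∈ ⋀[K]^2 V)
    (hnondeg : ω ^ n ≠ 0) :
    ∀ α ∈ ⋀[K]^2 V, ω * α = 0 → α = 0 := by
  intro α hα h
  obtain ⟨t, ht⟩ := ExteriorAlgebra.exists_smul_eq_of_mul_eq_zero hω hα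
    (ExteriorAlgebra.contractBivector_injective hdim hω hnondeg) h
  have hdim4 : (Module.finrank K V : K) - 4 ≠ 0 := by
    rw [sub_ne_zero, hdim]
    exact_mod_cast (by omega : 2 * n ≠ 4)
  have hω2 : ω * ω ≠ 0 := by
    rw [← pow_two]
    exact fun h0 => hnondeg (pow_eq_zero_of_le (by omega) h0)
  have ht0 : t = 0 := by
    have h2 : t • (ω * ω) = 0 := by rw [← mul_smul_comm, ← ht, mul_smul_comm, h, smul_zero]
    exact (smul_eq_zero.mp h2).resolve_right hω2
  rw [ht0, zero_smul] at ht
  exact (smul_eq_zero.mp ht).resolve_left hdim4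
end

section
/- Let g be a Lie algebra over a field K of characteristic zero with dim g = 2n, n ≥ 3, let ω be a nondegenerate alternating bilinear form on g (for every x ≠ 0 there is y with ω(x,y) ≠ 0), and let θ be a 1-form on g such that dω = θ∧ω, i.e., ω([x,y],z) + ω([y,z],x) + ω([z,x],y) + θ(x)ω(y,z) − θ(y)ω(x,z) + θ(z)ω(x,y) = 0 for all x,y,z ∈ g. Then θ is closed: θ([x,y]) = 0 for all x,y ∈ g. (In complex dimension greater than 2, the equation dω = θ∧ω forces dθ = 0.) -/
open Module in
/-- Fewer than `finrank K V` linear forms on `V` have a common nonzero zero. -/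
theorem exists_ne_zero_forall_eq_zero_of_lt_finrank {K V : Type*} [Field K] [AddCommGroup V]
    [Module K V] [FiniteDimensional K V] {k : ℕ} (hk : k < finrank K V) (f : Fin k → V →ₗ[K] K) :
    ∃ v : V, v ≠ 0 ∧ ∀ i, f i v = 0 := by
  have h : LinearMap.ker (LinearMap.pi f) ≠ ⊥ :=
    LinearMap.ker_ne_bot_of_finrank_lt (by simpa using hk)
  obtain ⟨v, hv, hv0⟩ := Submodule.exists_mem_ne_zero_of_ne_bot h
  exact ⟨v, hv0, fun i => congrFun (LinearMap.mem_ker.mp hv) i⟩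

/-- Projection onto the orthogonal complement of a hyperbolic plane of an alternating form. -/
theorem exists_orthogonal_hyperbolic {K V : Type*} [Field K] [AddCommGroup V] [Module K V]
    (ω : V →ₗ[K] V →ₗ[K] K) (hω : ω.IsAlt) {x y : V} (hxy : ω x y ≠ 0) (v : V) :
    ∃ v' : V, ω x v' = 0 ∧ ω y v' = 0 ∧
      ∀ u, ω x u = 0 → ω y u = 0 → ω u v' = ω u v := by
  have hyx : ω y x = -ω x y := (hω.neg x y).symm
  refine ⟨v - (ω x v / ω x y) • y + (ω y v / ω x y) • x, ?_, ?_, fun u hx hy => ?_⟩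
  · simp [hω.self_eq_zero, hxy]
  · simp [hω.self_eq_zero, hyx, hxy]
  · have hx' : ω u x = 0 := by rw [← hω.neg x u, hx, neg_zero]
    have hy' : ω u y = 0 := by rw [← hω.neg y u, hy, neg_zero]
    simp [hx', hy']

/-- In dimension at least `5`, wedging with a nondegenerate alternating form `ω` is injective on
alternating bilinear forms. -/
theorem eq_zero_of_wedge_nondegenerate_eq_zero {K V : Type*} [Field K] [CharZero K]
    [AddCommGroup V] [Module K V] [FiniteDimensional K V] (hV : 4 < Module.finrank K V)
    (ω α : V →ₗ[K] V →ₗ[K] K) (hω : ω.IsAlt)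
    (hnd : ∀ x, x ≠ 0 → ∃ y, ω x y ≠ 0)
    (h : ∀ x y z w, α x y * ω z w - α x z * ω y w + α x w * ω y z
      + α y z * ω x w - α y w * ω x z + α z w * ω x y = 0) : α = 0 := by
  have key : ∀ x y, ω x y ≠ 0 → α x y = 0 := by
    intro x y hxy
    obtain ⟨z, hz0, hz⟩ :=
      exists_ne_zero_forall_eq_zero_of_lt_finrank (by omega) ![ω x, ω y]
    have hxz : ω x z = 0 := hz 0
    have hyz : ω y z = 0 := hz 1
    obtain ⟨w₀, hw₀⟩ := hnd z hz0
    obtain ⟨w, hxw, hyw, hw⟩ := exists_orthogonal_hyperbolic ω hω hxy w₀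
    have hzw : ω z w ≠ 0 := by rwa [hw z hxz hyz]
    obtain ⟨u, hu0, hu⟩ :=
      exists_ne_zero_forall_eq_zero_of_lt_finrank hV ![ω x, ω y, ω z, ω w]
    have hxu : ω x u = 0 := hu 0
    have hyu : ω y u = 0 := hu 1
    have hzu : ω z u = 0 := hu 2
    have hwu : ω w u = 0 := hu 3
    obtain ⟨v₀, hv₀⟩ := hnd u hu0
    obtain ⟨v₁, hxv₁, hyv₁, hv₁⟩ := exists_orthogonal_hyperbolic ω hω hxy v₀
    obtain ⟨v, hzv, hwv, hv⟩ := exists_orthogonal_hyperbolic ω hω hzw v₁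
    have huv : ω u v ≠ 0 := by rwa [hv u hzu hwu, hv₁ u hxu hyu]
    have hswap : ∀ {a b}, ω a b = 0 → ω b a = 0 := fun {a b} hab => hω.isRefl a b hab
    have hxv : ω x v = 0 := by
      have := hv x (hswap hxz) (hswap hxw)
      rw [this, hxv₁]
    have hyv : ω y v = 0 := by
      have := hv y (hswap hyz) (hswap hyw)
      rw [this, hyv₁]
    have h₁ := h x y z w
    have h₂ := h x y u v
    have h₃ := h z w u v
    simp only [hxz, hyz, hxw, hyw, hxu, hyu, hzu, hwu, hxv, hyv, hzv, hwv, mul_zero, sub_zero,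
      add_zero] at h₁ h₂ h₃
    have h₄ : 2 * (ω z w * ω u v) * α x y = 0 := by
      linear_combination ω u v * h₁ + ω z w * h₂ - ω x y * h₃
    simpa [hzw, huv] using h₄
  ext x y
  by_cases hxy : ω x y = 0
  · by_cases hx : x = 0
    · simp [hx]
    obtain ⟨y', hy'⟩ := hnd x hx
    have h₁ := key x (y + y') (by simpa [hxy] using hy')
    simpa [key x y' hy'] using h₁
  · exact key x y hxy

/-- If `dω = θ ∧ ω` for an alternating bilinear form `ω`, then `dθ ∧ ω = 0`. -/
theorem wedge_eq_zero_of_differential_eq_wedge {K g : Type*} [Field K] [LieRing g]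
    [LieAlgebra K g] (ω : g →ₗ[K] g →ₗ[K] K) (hω : ω.IsAlt) (θ : g →ₗ[K] K)
    (h : ∀ x y z : g, ω ⁅x, y⁆ z + ω ⁅y, z⁆ x + ω ⁅z, x⁆ y
        + θ x * ω y z - θ y * ω x z + θ z * ω x y = 0) (x y z w : g) :
    θ ⁅x, y⁆ * ω z w - θ ⁅x, z⁆ * ω y w + θ ⁅x, w⁆ * ω y z
      + θ ⁅y, z⁆ * ω x w - θ ⁅y, w⁆ * ω x z + θ ⁅z, w⁆ * ω x y = 0 := by
  have anti : ∀ a b, ω a b = -ω b a := fun a b => (hω.neg b a).symm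
  have skew : ∀ a b c : g, ω ⁅a, b⁆ c = -ω ⁅b, a⁆ c := fun a b c => by
    rw [← lie_skew b a, map_neg, LinearMap.neg_apply, neg_neg]
  have jac : ∀ a b c d : g, ω ⁅⁅a, b⁆, c⁆ d + ω ⁅⁅b, c⁆, a⁆ d - ω ⁅⁅a, c⁆, b⁆ d = 0 :=
    fun a b c d => by
      have e : ⁅⁅a, b⁆, c⁆ + ⁅⁅b, c⁆, a⁆ - ⁅⁅a, c⁆, b⁆ = 0 := by
        rw [lie_lie a b c, ← lie_skew ⁅b, c⁆ a, ← lie_skew ⁅a, c⁆ b]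
        abel
      simpa only [map_add, map_sub, map_zero, LinearMap.add_apply, LinearMap.sub_apply,
        LinearMap.zero_apply] using congrArg (fun v => ω v d) e
  have dd : ∀ a b c d : g, ω ⁅⁅a, b⁆, c⁆ d + ω ⁅c, d⁆ ⁅a, b⁆ - ω ⁅⁅a, b⁆, d⁆ c
      + θ ⁅a, b⁆ * ω c d - θ c * ω ⁅a, b⁆ d + θ d * ω ⁅a, b⁆ c = 0 := fun a b c d => by
    linear_combination h ⁅a, b⁆ c d - skew d ⁅a, b⁆ c
  linear_combination dd x y z w + dd z w x y - dd x z y w - dd y w x z + dd x w y z + dd y z x w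
    - θ w * h x y z + θ z * h x y w - θ y * h x z w + θ x * h y z w
    - jac x y z w + jac x y w z - jac x z w y + jac y z w x
    - anti ⁅x, y⁆ ⁅z, w⁆ + anti ⁅x, z⁆ ⁅y, w⁆ - anti ⁅x, w⁆ ⁅y, z⁆
    + θ w * skew z x y - θ z * skew w x y + θ y * skew w x z - θ x * skew w y z

/-- In dimension `2n ≥ 6`, if `ω` is a nondegenerate alternating 2-form on a
Lie algebra `g` and `dω = θ ∧ ω` for a 1-form `θ`, then `θ` is closed. -/
theorem lee_form_closed_of_LCK
    (K : Type*) [Field K] [CharZero K]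
    (g : Type*) [LieRing g] [LieAlgebra K g] [FiniteDimensional K g]
    (n : ℕ) (hn : 3 ≤ n) (hdim : Module.finrank K g = 2 * n)
    (ω : g →ₗ[K] g →ₗ[K] K) (hω_alt : ∀ x : g, ω x x = 0)
    (hω_nondeg : ∀ x : g, x ≠ 0 → ∃ y : g, ω x y ≠ 0)
    (θ : g →ₗ[K] K)
    (hLCK : ∀ x y z : g,
      ω ⁅x, y⁆ z + ω ⁅y, z⁆ x + ω ⁅z, x⁆ y
        + θ x * ω y z - θ y * ω x z + θ z * ω x y = 0) :
    ∀ x y : g, θ ⁅x, y⁆ = 0 := by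
  have halt : ω.IsAlt := hω_alt
  let α : g →ₗ[K] g →ₗ[K] K := (LieModule.toEnd K g g : g →ₗ[K] Module.End K g).compr₂ θ
  have hα : α = 0 := eq_zero_of_wedge_nondegenerate_eq_zero (by omega) ω α halt
    hω_nondeg
    (wedge_eq_zero_of_differential_eq_wedge ω halt θ hLCK)
  intro x y
  exact LinearMap.congr_fun₂ hα x y
end

section
/- Fix n ≥ 2 and let g be the Lie algebra ℝ^{n−1} × ℝ^{n−1} × ℝ × ℝ with bracket [(a,b,c,t), (a',b',c',t')] = (0, 0, ⟨a,b'⟩ − ⟨b,a'⟩, 0) (the product of the Heisenberg algebra h_{2n−1} with ℝ). Define θ(a,b,c,t) = t, I(a,b,c,t) = (−b, a, t, −c), and ω((a,b,c,t),(a',b',c',t')) = ⟨a,b'⟩ − ⟨b,a'⟩ − (c t' − c' t). Then: (i) θ is a nonzero closed 1-form; (ii) I∘I = −id and the Nijenhuis tensor of I vanishes; (iii) ω is alternating with ω(Ix,Iy) = ω(x,y) for all x,y and ω(x,Ix) > 0 for all x ≠ 0; and (iv) dω = θ∧ω, i.e., ω([x,y],z) + ω([y,z],x) + ω([z,x],y)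 + θ(x)ω(y,z) − θ(y)ω(x,z) + θ(z)ω(x,y) = 0 for all x,y,z ∈ g. Hence (I, ω, θ) is an LCK structure on g with Lee form θ. -/
/-- The underlying vector space `ℝ^m × ℝ^m × ℝ × ℝ` of `h_{2m+1} × ℝ`. -/
abbrev HeisProd (m : ℕ) : Type := (Fin m → ℝ) × (Fin m → ℝ) × ℝ × ℝ

/-- The bracket `[(a,b,c,t), (a',b',c',t')] = (0, 0, ⟨a,b'⟩ − ⟨b,a'⟩, 0)` of
the Lie algebra `h_{2m+1} × ℝ`. -/
def heisBr {m : ℕ} (x y : HeisProd m) : HeisProd m :=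
  (0, 0, (∑ i, x.1 i * y.2.1 i) - (∑ i, x.2.1 i * y.1 i), 0)

/-- The Lee form `θ(a,b,c,t) = t`. -/
def heisTheta {m : ℕ} (x : HeisProd m) : ℝ := x.2.2.2

/-- The complex structure `I(a,b,c,t) = (−b, a, t, −c)`. -/
def heisI {m : ℕ} (x : HeisProd m) : HeisProd m :=
  (-x.2.1, x.1, x.2.2.2, -x.2.2.1)

/-- The fundamental form
`ω((a,b,c,t),(a',b',c',t')) = ⟨a,b'⟩ − ⟨b,a'⟩ − (c t' − c' t)`. -/
def heisOmega {m : ℕ} (x y : HeisProd m) : ℝ :=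
  ((∑ i, x.1 i * y.2.1 i) - (∑ i, x.2.1 i * y.1 i))
    - (x.2.2.1 * y.2.2.2 - y.2.2.1 * x.2.2.2)

section HeisProd

variable {m : ℕ}

theorem isLinearMap_heisTheta : IsLinearMap ℝ (heisTheta (m := m)) :=
  ⟨fun _ _ => rfl, fun _ _ => rfl⟩

theorem heisTheta_ne_zero : heisTheta (m := m) ≠ 0 := fun h =>
  one_ne_zero (α := ℝ) (congrFun h (0, 0, 0, 1))

theorem isLinearMap_heisI : IsLinearMap ℝ (heisI (m := m)) := by
  constructor
  · intro x y
    simp only [heisI, Prod.fst_add, Prod.snd_add, Prod.mk_add_mk, neg_add]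
  · intro r x
    simp only [heisI, Prod.smul_fst, Prod.smul_snd, Prod.smul_mk, smul_neg]

theorem heisI_heisI (x : HeisProd m) : heisI (heisI x) = -x := rfl

theorem nijenhuis_heisI (x y : HeisProd m) :
    heisBr (heisI x) (heisI y) - heisBr x y
      - heisI (heisBr (heisI x) y) - heisI (heisBr x (heisI y)) = 0 := by
  simp only [heisBr, heisI, Pi.neg_apply, neg_mul, mul_neg, Finset.sum_neg_distrib]
  ext <;> simp
  ring

theorem heisOmega_swap (x y : HeisProd m) : heisOmega y x = -heisOmega x y := by
  simp only [heisOmega, mul_comm (y.1 _), mul_comm (y.2.1 _)]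
  ring

theorem isLinearMap_heisOmega_right (x : HeisProd m) :
    IsLinearMap ℝ (fun y => heisOmega x y) := by
  constructor
  · intro y z
    simp only [heisOmega, Prod.fst_add, Prod.snd_add, Pi.add_apply, mul_add,
      Finset.sum_add_distrib]
    ring
  · intro r y
    simp only [heisOmega, Prod.smul_fst, Prod.smul_snd, Pi.smul_apply, smul_eq_mul,
      mul_left_comm _ r, ← Finset.mul_sum]
    ring

theorem isLinearMap_heisOmega_left (y : HeisProd m) :
    IsLinearMap ℝ (fun x => heisOmega x y) := by
  simp only [heisOmega_swap y]
  exact (-(isLinearMap_heisOmega_right y).mk').isLinear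

theorem heisOmega_self (x : HeisProd m) : heisOmega x x = 0 :=
  self_eq_neg.mp (heisOmega_swap x x)

theorem heisOmega_heisI_heisI (x y : HeisProd m) :
    heisOmega (heisI x) (heisI y) = heisOmega x y := by
  simp only [heisOmega, heisI, Pi.neg_apply, neg_mul, mul_neg, Finset.sum_neg_distrib]
  ring

theorem heisOmega_heisI_self (x : HeisProd m) :
    heisOmega x (heisI x) =
      ∑ i, x.1 i ^ 2 + ∑ i, x.2.1 i ^ 2 + x.2.2.1 ^ 2 + x.2.2.2 ^ 2 := by
  simp only [heisOmega, heisI, Pi.neg_apply, mul_neg, Finset.sum_neg_distrib, sq]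
  ring

theorem heisOmega_heisI_self_pos {x : HeisProd m} (hx : x ≠ 0) :
    0 < heisOmega x (heisI x) := by
  rw [heisOmega_heisI_self]
  have ha : 0 ≤ ∑ i, x.1 i ^ 2 := Finset.sum_nonneg fun i _ => sq_nonneg _
  have hb : 0 ≤ ∑ i, x.2.1 i ^ 2 := Finset.sum_nonneg fun i _ => sq_nonneg _
  have hc := sq_nonneg x.2.2.1
  have ht := sq_nonneg x.2.2.2
  by_contra! h
  have ha' : ∑ i, x.1 i ^ 2 = 0 := by linarith
  have hb' : ∑ i, x.2.1 i ^ 2 = 0 := by linarith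
  have hc' : x.2.2.1 ^ 2 = 0 := by linarith
  have ht' : x.2.2.2 ^ 2 = 0 := by linarith
  rw [Finset.sum_eq_zero_iff_of_nonneg fun i _ => sq_nonneg _] at ha' hb'
  refine hx (Prod.ext (funext fun i => ?_) (Prod.ext (funext fun i => ?_) (Prod.ext ?_ ?_)))
  · exact pow_eq_zero_iff two_ne_zero |>.mp (ha' i (Finset.mem_univ i))
  · exact pow_eq_zero_iff two_ne_zero |>.mp (hb' i (Finset.mem_univ i))
  · exact pow_eq_zero_iff two_ne_zero |>.mp hc'
  · exact pow_eq_zero_iff two_ne_zero |>.mp ht'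

theorem heisOmega_heisBr (x y z : HeisProd m) :
    heisOmega (heisBr x y) z =
      -(heisOmega x y + (x.2.2.1 * y.2.2.2 - y.2.2.1 * x.2.2.2)) * z.2.2.2 := by
  simp [heisOmega, heisBr]
  ring

theorem d_heisOmega (x y z : HeisProd m) :
    heisOmega (heisBr x y) z + heisOmega (heisBr y z) x + heisOmega (heisBr z x) y
      + heisTheta x * heisOmega y z - heisTheta y * heisOmega x z
      + heisTheta z * heisOmega x y = 0 := by
  simp only [heisOmega_heisBr, heisTheta, heisOmega_swap x z]
  ring

end HeisProd

/-- `(heisI, heisOmega, heisTheta)` is an LCK (in fact Vaisman) structure on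
the Lie algebra `h_{2n−1} × ℝ`: `θ` is a nonzero closed 1-form, `I` is a
complex structure (with vanishing Nijenhuis tensor), `ω` is an alternating,
`I`-invariant, positive 2-form, and `dω = θ ∧ ω`. -/
theorem heisenberg_prod_LCK_structure (n : ℕ) (hn : 2 ≤ n) :
    -- (i) θ is a nonzero closed 1-form
    (IsLinearMap ℝ (heisTheta (m := n - 1))) ∧
    (heisTheta (m := n - 1)) ≠ 0 ∧
    (∀ x y : HeisProd (n - 1), heisTheta (heisBr x y) = 0) ∧
    -- (ii) I is a complex structure with vanishing Nijenhuis tensor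
    (IsLinearMap ℝ (heisI (m := n - 1))) ∧
    (∀ x : HeisProd (n - 1), heisI (heisI x) = -x) ∧
    (∀ x y : HeisProd (n - 1),
      heisBr (heisI x) (heisI y) - heisBr x y
        - heisI (heisBr (heisI x) y) - heisI (heisBr x (heisI y)) = 0) ∧
    -- (iii) ω is an alternating bilinear (1,1)-form, positive on (x, Ix)
    (∀ y : HeisProd (n - 1), IsLinearMap ℝ (fun x => heisOmega x y)) ∧
    (∀ x : HeisProd (n - 1), IsLinearMap ℝ (fun y => heisOmega x y)) ∧
    (∀ x : HeisProd (n - 1), heisOmega x x = 0) ∧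
    (∀ x y : HeisProd (n - 1), heisOmega (heisI x) (heisI y) = heisOmega x y) ∧
    (∀ x : HeisProd (n - 1), x ≠ 0 → 0 < heisOmega x (heisI x)) ∧
    -- (iv) dω = θ ∧ ω
    (∀ x y z : HeisProd (n - 1),
      heisOmega (heisBr x y) z + heisOmega (heisBr y z) x + heisOmega (heisBr z x) y
        + heisTheta x * heisOmega y z - heisTheta y * heisOmega x z
        + heisTheta z * heisOmega x y = 0) := by
  exact ⟨isLinearMap_heisTheta, heisTheta_ne_zero, fun _ _ => rfl, isLinearMap_heisI,
    heisI_heisI, nijenhuis_heisI, isLinearMap_heisOmega_left, isLinearMap_heisOmega_right,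
    heisOmega_self, heisOmega_heisI_heisI, fun _ => heisOmega_heisI_self_pos, d_heisOmega⟩
end
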